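/- arXiv:1708.02157 — 4 statements merged into one kernel-verified Lean document; each statement's English description precedes it below -/
import Mathlib

section
/- Let Ω ⊆ ℝ^d be open, ρ_1,…,ρ_m ∈ C₀(Ω), and H : M(Ω) → ℝ^m the associated measurement operator. Suppose f_b : ℝ^m → ℝ ∪ {+∞} is lower semicontinuous and coercive (f_b(x) → +∞ as ‖x‖₂ → ∞), and there exists μ ∈ M(Ω) with f_b(Hμ) < +∞. Then the infimum inf_{μ ∈ M(Ω)} f_b(Hμ) + ‖μ‖_TV is attained. -/
open MeasureTheory Filter Topology

/-- The total variation norm of a finite signed Borel measure. -/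
noncomputable def tv {α : Type*} [MeasurableSpace α] (μ : SignedMeasure α) : ℝ :=
  (μ.totalVariation Set.univ).toReal

/-- Integration of a real function against a finite signed Borel measure. -/
noncomputable def sint {α : Type*} [MeasurableSpace α] (μ : SignedMeasure α) (f : α → ℝ) : ℝ :=
  ∫ x, f x ∂μ.toJordanDecomposition.posPart - ∫ x, f x ∂μ.toJordanDecomposition.negPart

/-- In a finite-dimensional space, the convex hull of a compact set is compact. -/
theorem IsCompact.convexHull_of_finiteDimensional {E : Type*} [NormedAddCommGroup E]
    [NormedSpace ℝ E] [FiniteDimensional ℝ E] {s : Set E} (hs : IsCompact s) :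
    IsCompact (convexHull ℝ s) := by
  rcases s.eq_empty_or_nonempty with rfl | ⟨a, ha⟩
  · simp
  let k := Module.finrank ℝ E + 1
  let g : (Fin k → ℝ) × (Fin k → E) → E := fun q => ∑ i, q.1 i • q.2 i
  have hg : Continuous g := by fun_prop
  have hK : IsCompact (stdSimplex ℝ (Fin k) ×ˢ Set.univ.pi fun _ : Fin k => s) :=
    (isCompact_stdSimplex ℝ (Fin k)).prod (isCompact_univ_pi fun _ => hs)
  convert hK.image hg
  apply Set.Subset.antisymm
  · intro x hx
    obtain ⟨ι, _, z, w, hz, hind, hw, hw1, rfl⟩ := eq_pos_convex_span_of_mem_convexHull hx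
    have hcard : Fintype.card ι ≤ Fintype.card (Fin k) := by
      rw [Fintype.card_fin]
      exact hind.card_le_finrank_succ.trans
        (Nat.add_le_add_right (Submodule.finrank_le _) 1)
    obtain ⟨e⟩ := Function.Embedding.nonempty_of_card_le hcard
    have hwe : ∀ i ∉ Set.range e, Function.extend e w 0 i = 0 := fun i hi =>
      Function.extend_apply' _ _ _ hi
    refine ⟨(Function.extend e w 0, Function.extend e z fun _ => a), ⟨⟨fun i => ?_, ?_⟩, ?_⟩, ?_⟩
    · by_cases hi : i ∈ Set.range e
      · obtain ⟨j, rfl⟩ := hi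
        simpa [e.injective.extend_apply] using (hw j).le
      · exact (hwe i hi).ge
    · rw [← hw1]
      exact (Fintype.sum_of_injective e e.injective _ _ hwe
        fun i => (e.injective.extend_apply w 0 i).symm).symm
    · intro i _
      by_cases hi : i ∈ Set.range e
      · obtain ⟨j, rfl⟩ := hi
        simpa [e.injective.extend_apply] using hz (Set.mem_range_self j)
      · simpa [Function.extend_apply' _ _ _ hi] using ha
    · refine (Fintype.sum_of_injective e e.injective _ _ (fun i hi => ?_) fun i => ?_).symm
      · simp [hwe i hi]
      · simp [e.injective.extend_apply]
  · rintro _ ⟨⟨w, z⟩, ⟨hw, hz⟩, rfl⟩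
    exact (convex_convexHull ℝ s).sum_mem (fun i _ => hw.1 i) hw.2
      fun i _ => subset_convexHull ℝ s (hz i trivial)

open scoped Pointwise

section SignedMeasure

variable {X : Type*} [MeasurableSpace X]

theorem tv_eq (μ : SignedMeasure X) :
    tv μ = μ.toJordanDecomposition.posPart.real Set.univ +
      μ.toJordanDecomposition.negPart.real Set.univ := by
  rw [tv, SignedMeasure.totalVariation, ← measureReal_def, measureReal_add_apply]

theorem tv_nonneg (μ : SignedMeasure X) : 0 ≤ tv μ := ENNReal.toReal_nonneg

/-- The Jordan decomposition of a difference of finite measures has minimal mass. -/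
theorem tv_sub_le (p n : Measure X) [IsFiniteMeasure p] [IsFiniteMeasure n] :
    tv (p.toSignedMeasure - n.toSignedMeasure) ≤ p.real Set.univ + n.real Set.univ := by
  set s := p.toSignedMeasure - n.toSignedMeasure with hs
  have hval : ∀ i, MeasurableSet i → s i = p.real i - n.real i := fun i hi => by
    rw [hs, Measure.toSignedMeasure_sub_apply hi]
  obtain ⟨i, hi, hpos, hneg⟩ := s.toJordanDecomposition.mutuallySingular
  have hposr : s.toJordanDecomposition.posPart.real i = 0 := by simp [measureReal_def, hpos]
  have hnegr : s.toJordanDecomposition.negPart.real iᶜ = 0 := by simp [measureReal_def, hneg]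
  have h1 := s.apply_eq_posPart_real_sub_negPart_real hi
  have h2 := s.apply_eq_posPart_real_sub_negPart_real hi.compl
  rw [hval _ hi] at h1
  rw [hval _ hi.compl] at h2
  have := measureReal_add_measureReal_compl (μ := s.toJordanDecomposition.posPart) hi
  have := measureReal_add_measureReal_compl (μ := s.toJordanDecomposition.negPart) hi
  have := measureReal_add_measureReal_compl (μ := p) hi
  have := measureReal_add_measureReal_compl (μ := n) hi
  have : 0 ≤ p.real i := measureReal_nonneg
  have : 0 ≤ n.real iᶜ := measureReal_nonneg
  rw [tv_eq]
  linarith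

theorem sint_sub (p n : Measure X) [IsFiniteMeasure p] [IsFiniteMeasure n] {f : X → ℝ}
    (hf : ∀ ν : Measure X, IsFiniteMeasure ν → Integrable f ν) :
    sint (p.toSignedMeasure - n.toSignedMeasure) f = ∫ x, f x ∂p - ∫ x, f x ∂n := by
  set s := p.toSignedMeasure - n.toSignedMeasure with hs
  have h : s.toJordanDecomposition.posPart + n = s.toJordanDecomposition.negPart + p := by
    rw [← Measure.toSignedMeasure_eq_toSignedMeasure_iff, Measure.toSignedMeasure_add,
      Measure.toSignedMeasure_add]
    have := s.toSignedMeasure_toJordanDecomposition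
    rw [JordanDecomposition.toSignedMeasure, hs, sub_eq_sub_iff_add_eq_add] at this
    rw [this, add_comm]
  have h' := congrArg (fun ν => ∫ x, f x ∂ν) h
  rw [integral_add_measure (hf _ inferInstance) (hf _ inferInstance),
    integral_add_measure (hf _ inferInstance) (hf _ inferInstance)] at h'
  rw [sint]
  linarith

variable {E : Type*} [NormedAddCommGroup E] [NormedSpace ℝ E] [FiniteDimensional ℝ E]

theorem Convex.integral_mem_smul {C : Set E} (hC : Convex ℝ C) (hcl : IsClosed C)
    (h0 : (0 : E) ∈ C) {v : X → E} (hv : ∀ x, v x ∈ C) (ν : Measure X) [IsFiniteMeasure ν]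
    (hint : Integrable v ν) : ∫ x, v x ∂ν ∈ ν.real Set.univ • C := by
  rcases eq_zero_or_neZero ν with rfl | _
  · exact ⟨0, h0, by simp⟩
  · exact ⟨⨍ x, v x ∂ν, hC.average_mem hcl (ae_of_all _ hv) hint, measure_smul_average ν v⟩

/-- Points of the symmetric convex hull of the values of `v` are differences of integrals of `v`
against finite measures of total mass at most one. -/
theorem exists_measure_of_mem_convexHull {v : X → E}
    (hvm : StronglyMeasurable v) (hv : ∀ ν : Measure X, IsFiniteMeasure ν → Integrable v ν) {y : E}
    (hy : y ∈ convexHull ℝ (insert 0 (Set.range v) ∪ -insert 0 (Set.range v))) :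
    ∃ p n : Measure X, IsFiniteMeasure p ∧ IsFiniteMeasure n ∧
      ∫ x, v x ∂p - ∫ x, v x ∂n = y ∧ p.real Set.univ + n.real Set.univ ≤ 1 := by
  let D : Set E := {y | ∃ p n : Measure X, IsFiniteMeasure p ∧ IsFiniteMeasure n ∧
      ∫ x, v x ∂p - ∫ x, v x ∂n = y ∧ p.real Set.univ + n.real Set.univ ≤ 1}
  have hzero : (0 : E) ∈ D := ⟨0, 0, inferInstance, inferInstance, by simp, by simp⟩
  have hD : Convex ℝ D := by
    rintro _ ⟨p₁, n₁, _, _, rfl, h₁⟩ _ ⟨p₂, n₂, _, _, rfl, h₂⟩ a b ha hb hab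
    lift a to NNReal using ha
    lift b to NNReal using hb
    refine ⟨a • p₁ + b • p₂, a • n₁ + b • n₂, inferInstance, inferInstance, ?_, ?_⟩
    · rw [integral_add_measure (hv _ inferInstance) (hv _ inferInstance),
        integral_add_measure (hv _ inferInstance) (hv _ inferInstance)]
      simp only [integral_smul_nnreal_measure, NNReal.smul_def]
      module
    · rw [measureReal_add_apply, measureReal_add_apply]
      simp only [measureReal_nnreal_smul_apply]
      have := mul_le_mul_of_nonneg_left h₁ a.coe_nonneg
      have := mul_le_mul_of_nonneg_left h₂ b.coe_nonneg
      linarith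
  have hsub : insert 0 (Set.range v) ∪ -insert 0 (Set.range v) ⊆ D := by
    rintro y (hy | hy)
    · rcases hy with rfl | ⟨x, rfl⟩
      · exact hzero
      · exact ⟨.dirac x, 0, inferInstance, inferInstance,
          by simp [integral_dirac' _ _ hvm], by simp⟩
    · rcases hy with hy | ⟨x, hx⟩
      · rwa [neg_eq_zero.1 hy]
      · exact ⟨0, .dirac x, inferInstance, inferInstance,
          by simp [integral_dirac' _ _ hvm, hx], by simp⟩
  exact convexHull_min hsub hD hy

end SignedMeasure

/-- A coercive lower semicontinuous function which is never `-∞` is bounded below by a real. -/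
theorem LowerSemicontinuous.exists_real_le {E : Type*} [TopologicalSpace E] {f : E → EReal}
    (hf : LowerSemicontinuous f) (hbot : ∀ x, f x ≠ ⊥)
    (hcoer : Tendsto f (cocompact E) (𝓝 ⊤)) : ∃ c : ℝ, ∀ x, (c : EReal) ≤ f x := by
  obtain ⟨K, hK, hKf⟩ := mem_cocompact.1 (hcoer.eventually (lt_mem_nhds EReal.zero_lt_top))
  have hout : ∀ x ∉ K, (0 : EReal) ≤ f x := fun x hx => le_of_lt (hKf hx)
  rcases K.eq_empty_or_nonempty with rfl | hne
  · exact ⟨0, fun x => hout x (by simp)⟩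
  obtain ⟨a, -, ha⟩ := LowerSemicontinuousOn.exists_isMinOn hne hK (hf.lowerSemicontinuousOn K)
  obtain ⟨r, hr⟩ : ∃ r : ℝ, (r : EReal) ≤ f a := by
    obtain ⟨r, -, hr⟩ := EReal.lt_iff_exists_real_btwn.1 (bot_lt_iff_ne_bot.2 (hbot a))
    exact ⟨r, hr.le⟩
  refine ⟨min r 0, fun x => ?_⟩
  by_cases hx : x ∈ K
  · exact (EReal.coe_le_coe_iff.2 (min_le_left _ _)).trans (hr.trans (ha hx))
  · exact (EReal.coe_le_coe_iff.2 (min_le_right _ _)).trans (hout x hx)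

/-- If `f_b` is lower semicontinuous, coercive and somewhere finite along the range of the
measurement operator `H` (given by integration against functions `ρ i ∈ C₀(Ω)`), then the
problem `inf_μ f_b(Hμ) + ‖μ‖_TV` over the finite signed Borel measures on an open `Ω ⊆ ℝ^d`
attains its infimum. -/
theorem stmt0 {d m : ℕ} (Ω : Set (Fin d → ℝ)) (hΩ : IsOpen Ω)
    (ρ : Fin m → ZeroAtInftyContinuousMap Ω ℝ)
    (H : SignedMeasure Ω → Fin m → ℝ)
    (hH : ∀ μ i, H μ i = sint μ (fun x => ρ i x))
    (f : (Fin m → ℝ) → EReal)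
    (hbot : ∀ x, f x ≠ ⊥)
    (hlsc : LowerSemicontinuous f)
    (hcoer : Tendsto f (cocompact (Fin m → ℝ)) (𝓝 ⊤))
    (hfeas : ∃ μ : SignedMeasure Ω, f (H μ) < ⊤) :
    ∃ μhat : SignedMeasure Ω, ∀ μ : SignedMeasure Ω,
      f (H μhat) + (tv μhat : EReal) ≤ f (H μ) + (tv μ : EReal) := by
  let v : Ω → Fin m → ℝ := fun x i => ρ i x
  have hvc : Continuous v := by fun_prop
  have hvint : ∀ (ν : Measure Ω), IsFiniteMeasure ν → ∀ i, Integrable (fun x => ρ i x) ν := by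
    intro ν _ i
    exact (ρ i).toBCF.integrable ν
  have hvint' : ∀ ν : Measure Ω, IsFiniteMeasure ν → Integrable v ν := fun ν hν =>
    Integrable.of_eval fun i => hvint ν hν i
  have heval : ∀ (ν : Measure Ω), IsFiniteMeasure ν → ∀ i,
      (∫ x, v x ∂ν) i = ∫ x, ρ i x ∂ν := fun ν hν i => eval_integral (fun i => hvint ν hν i) i
  have hHv : ∀ μ, H μ = ∫ x, v x ∂μ.toJordanDecomposition.posPart -
      ∫ x, v x ∂μ.toJordanDecomposition.negPart := by
    intro μ
    ext i
    rw [hH, sint, Pi.sub_apply, heval _ inferInstance, heval _ inferInstance]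
  set S : Set (Fin m → ℝ) := insert 0 (Set.range v) ∪ -insert 0 (Set.range v) with hS
  set C := convexHull ℝ S with hC
  have hcomp : IsCompact C := by
    have hvt : Tendsto v (cocompact Ω) (𝓝 0) :=
      tendsto_pi_nhds.2 fun i => (ρ i).zero_at_infty'
    have hr := hvt.isCompact_insert_range_of_cocompact hvc
    exact (hr.union hr.neg).convexHull_of_finiteDimensional
  have hconv : Convex ℝ C := convex_convexHull ℝ S
  have h0 : (0 : Fin m → ℝ) ∈ C := subset_convexHull ℝ S (by simp [hS])
  have hmem : ∀ μ, ∃ y ∈ C, H μ = tv μ • y := by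
    intro μ
    have h1 := hconv.integral_mem_smul hcomp.isClosed h0 (v := v)
      (fun x => subset_convexHull ℝ S (by simp [hS])) μ.toJordanDecomposition.posPart
      (hvint' _ inferInstance)
    have h2 := hconv.integral_mem_smul hcomp.isClosed h0 (v := fun x => -v x)
      (fun x => subset_convexHull ℝ S (by simp [hS])) μ.toJordanDecomposition.negPart
      (hvint' _ inferInstance).neg
    have h3 := Set.add_mem_add h1 h2
    rw [← hconv.add_smul measureReal_nonneg measureReal_nonneg, ← tv_eq, integral_neg,
      ← sub_eq_add_neg, ← hHv] at h3
    obtain ⟨y, hy, h⟩ := h3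
    exact ⟨y, hy, h.symm⟩
  have hreal : ∀ t : ℝ, 0 ≤ t → ∀ y ∈ C, ∃ μ, H μ = t • y ∧ tv μ ≤ t := by
    intro t ht y hy
    lift t to NNReal using ht
    obtain ⟨p, n, _, _, rfl, hpn⟩ :=
      exists_measure_of_mem_convexHull hvc.stronglyMeasurable hvint' hy
    refine ⟨(t • p).toSignedMeasure - (t • n).toSignedMeasure, ?_, ?_⟩
    · ext i
      rw [hH, sint_sub _ _ fun ν hν => hvint ν hν i]
      simp only [integral_smul_nnreal_measure, NNReal.smul_def, Pi.smul_apply, Pi.sub_apply,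
        heval p inferInstance, heval n inferInstance, smul_sub]
    · refine (tv_sub_le _ _).trans ?_
      simp only [measureReal_nnreal_smul_apply]
      have := mul_le_mul_of_nonneg_left hpn t.coe_nonneg
      linarith
  obtain ⟨c, hc⟩ := hlsc.exists_real_le hbot hcoer
  obtain ⟨μ₀, hμ₀⟩ := hfeas
  obtain ⟨r, hr⟩ : ∃ r : ℝ, f (H μ₀) = r :=
    ⟨_, (EReal.coe_toReal hμ₀.ne (hbot _)).symm⟩
  have hcr : c ≤ r := EReal.coe_le_coe_iff.1 (hr ▸ hc (H μ₀))
  set T : ℝ := r + tv μ₀ - c with hT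
  have hT0 : tv μ₀ ≤ T := by linarith
  let g : ℝ × (Fin m → ℝ) → EReal := fun q => f (q.1 • q.2) + (q.1 : EReal)
  have hg : LowerSemicontinuous g := by
    refine LowerSemicontinuous.add' (hlsc.comp (by fun_prop))
      (continuous_coe_real_ereal.comp continuous_fst).lowerSemicontinuous fun q => ?_
    exact EReal.continuousAt_add (Or.inr (by simp)) (Or.inr (by simp))
  obtain ⟨⟨t, y⟩, ⟨ht, hy⟩, hmin⟩ := LowerSemicontinuousOn.exists_isMinOn
    (s := Set.Icc 0 T ×ˢ C) ⟨(0, 0), ⟨le_rfl, (tv_nonneg μ₀).trans hT0⟩, h0⟩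
    (isCompact_Icc.prod hcomp) (hg.lowerSemicontinuousOn _)
  obtain ⟨μhat, hHhat, htv⟩ := hreal t ht.1 y hy
  have hhat : f (H μhat) + (tv μhat : EReal) ≤ g (t, y) := by
    simp only [g, hHhat]
    gcongr
  have hle : ∀ μ, tv μ ≤ T → f (H μhat) + (tv μhat : EReal) ≤ f (H μ) + (tv μ : EReal) := by
    intro μ hμ
    obtain ⟨z, hz, hHz⟩ := hmem μ
    refine hhat.trans ((hmin (Set.mk_mem_prod ⟨tv_nonneg μ, hμ⟩ hz)).trans_eq ?_)
    simp only [g, hHz]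
  refine ⟨μhat, fun μ => ?_⟩
  rcases le_total (tv μ) T with hμ | hμ
  · exact hle μ hμ
  · calc f (H μhat) + (tv μhat : EReal) ≤ f (H μ₀) + (tv μ₀ : EReal) := hle μ₀ hT0
      _ = ((c + T : ℝ) : EReal) := by rw [hr, ← EReal.coe_add, hT]; congr 1; ring
      _ = (c : EReal) + (T : EReal) := EReal.coe_add _ _
      _ ≤ f (H μ) + (tv μ : EReal) := add_le_add (hc _) (EReal.coe_le_coe_iff.2 hμ)
end

section
/- Let Ω ⊆ ℝ^d be open, ρ_1,…,ρ_m ∈ C₀(Ω), and H : M(Ω) → ℝ^m the associated measurement operator. For every y in the range of H, the problem min_{μ ∈ M(Ω)} ‖μ‖_TV subject to Hμ = y attains its minimum at a measure of the form μ̂ = Σ_{k=1}^p d_k δ_{x_k} with p ≤ m, d ∈ ℝ^p and points x_1,…,x_p ∈ Ω. -/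
open MeasureTheory Filter Topology

/-- The Dirac measure at `x`, as a signed measure. -/
noncomputable def sdirac {α : Type*} [MeasurableSpace α] (x : α) : SignedMeasure α :=
  (Measure.dirac x).toSignedMeasure

/-- Conic Carathéodory theorem with control of the total weight: a nonnegative combination can be
rewritten over a linearly independent subfamily without increasing the sum of the weights. -/
theorem exists_linearIndepOn_conic_combination {ι E : Type*} [AddCommGroup E] [Module ℝ E]
    (v : ι → E) (s : Finset ι) (c : ι → ℝ) (hc : ∀ i ∈ s, 0 ≤ c i) :
    ∃ (t : Finset ι) (c' : ι → ℝ), t ⊆ s ∧ (∀ i ∈ t, 0 ≤ c' i) ∧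
      ∑ i ∈ t, c' i • v i = ∑ i ∈ s, c i • v i ∧ ∑ i ∈ t, c' i ≤ ∑ i ∈ s, c i ∧
      LinearIndepOn ℝ v (t : Set ι) := by
  classical
  induction hn : s.card generalizing s c with
  | zero =>
    obtain rfl := Finset.card_eq_zero.mp hn
    exact ⟨∅, c, by simp⟩
  | succ n ih =>
    by_cases hli : LinearIndepOn ℝ v (s : Set ι)
    · exact ⟨s, c, Finset.Subset.refl s, hc, rfl, le_rfl, hli⟩
    obtain ⟨g, hg0, hgs, i₁, hi₁, hgi₁⟩ : ∃ g : ι → ℝ, ∑ i ∈ s, g i • v i = 0 ∧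
        0 ≤ ∑ i ∈ s, g i ∧ ∃ i ∈ s, g i ≠ 0 := by
      rw [linearIndepOn_finset_iff] at hli
      push Not at hli
      obtain ⟨g, hg0, i, hi, hgi⟩ := hli
      rcases le_total 0 (∑ i ∈ s, g i) with h | h
      · exact ⟨g, hg0, h, i, hi, hgi⟩
      · exact ⟨-g, by simp [hg0], by simpa using h, i, hi, by simpa using hgi⟩
    have hpos : (s.filter fun i => 0 < g i).Nonempty := by
      by_contra hne
      rw [Finset.not_nonempty_iff_eq_empty, Finset.filter_eq_empty_iff] at hne
      have hle : ∀ i ∈ s, g i ≤ 0 := fun i hi => not_lt.mp (hne hi)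
      have := Finset.sum_lt_sum hle ⟨i₁, hi₁, lt_of_le_of_ne (hle i₁ hi₁) hgi₁⟩
      simp only [Finset.sum_const_zero] at this
      linarith
    obtain ⟨i₀, hi₀, hmin⟩ := Finset.exists_min_image _ (fun i => c i / g i) hpos
    rw [Finset.mem_filter] at hi₀
    obtain ⟨hi₀s, hgi₀⟩ := hi₀
    set r : ℝ := c i₀ / g i₀ with hr
    have hr0 : 0 ≤ r := div_nonneg (hc i₀ hi₀s) hgi₀.le
    have hzero : c i₀ - r * g i₀ = 0 := by rw [hr]; field_simp; ring
    have hnn : ∀ i ∈ s, 0 ≤ c i - r * g i := by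
      intro i hi
      rcases lt_or_ge 0 (g i) with h | h
      · have := hmin i (Finset.mem_filter.mpr ⟨hi, h⟩)
        rw [le_div_iff₀ h] at this
        linarith
      · have := hc i hi
        nlinarith
    obtain ⟨t, c', hts, hc', hv, hw, hli'⟩ := ih (s.erase i₀) (fun i => c i - r * g i)
      (fun i hi => hnn i (Finset.mem_of_mem_erase hi)) (by simp [Finset.card_erase_of_mem hi₀s, hn])
    refine ⟨t, c', hts.trans (Finset.erase_subset _ _), hc', ?_, ?_, hli'⟩
    · rw [hv, Finset.sum_erase _ (by simp [hzero])]
      simp [sub_smul, Finset.sum_sub_distrib, mul_smul, ← Finset.smul_sum, hg0]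
    · rw [Finset.sum_erase (f := fun i => c i - r * g i) _ hzero, Finset.sum_sub_distrib, ← Finset.mul_sum] at hw
      nlinarith [mul_nonneg hr0 hgs]

theorem jordanDecomposition_add_eq_add {α : Type*} [MeasurableSpace α] (P N : Measure α)
    [IsFiniteMeasure P] [IsFiniteMeasure N] (μ : SignedMeasure α)
    (hμ : μ = P.toSignedMeasure - N.toSignedMeasure) :
    μ.toJordanDecomposition.posPart + N = P + μ.toJordanDecomposition.negPart := by
  have h := SignedMeasure.toSignedMeasure_toJordanDecomposition μ
  rw [JordanDecomposition.toSignedMeasure] at h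
  have h' := sub_eq_zero.mpr (h.trans hμ)
  rw [← Measure.toSignedMeasure_eq_toSignedMeasure_iff, Measure.toSignedMeasure_add,
    Measure.toSignedMeasure_add, ← sub_eq_zero, ← h']
  abel

theorem sint_eq_of_eq_sub {α : Type*} [MeasurableSpace α] (P N : Measure α)
    [IsFiniteMeasure P] [IsFiniteMeasure N] (μ : SignedMeasure α)
    (hμ : μ = P.toSignedMeasure - N.toSignedMeasure) (f : α → ℝ)
    (hf : ∀ (ν : Measure α) [IsFiniteMeasure ν], Integrable f ν) :
    sint μ f = ∫ x, f x ∂P - ∫ x, f x ∂N := by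
  have h := congrArg (fun ν => ∫ x, f x ∂ν) (jordanDecomposition_add_eq_add P N μ hμ)
  simp only [integral_add_measure (hf _) (hf _)] at h
  rw [sint]
  linarith

theorem tv_eq_add {α : Type*} [MeasurableSpace α] (μ : SignedMeasure α) :
    tv μ = μ.toJordanDecomposition.posPart.real Set.univ +
      μ.toJordanDecomposition.negPart.real Set.univ := by
  rw [tv, SignedMeasure.totalVariation, Measure.add_apply,
    ENNReal.toReal_add (measure_ne_top _ _) (measure_ne_top _ _)]
  rfl

theorem tv_le_of_eq_sub {α : Type*} [MeasurableSpace α] (P N : Measure α)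
    [IsFiniteMeasure P] [IsFiniteMeasure N] (μ : SignedMeasure α)
    (hμ : μ = P.toSignedMeasure - N.toSignedMeasure) :
    tv μ ≤ P.real Set.univ + N.real Set.univ := by
  have h := jordanDecomposition_add_eq_add P N μ hμ
  obtain ⟨S, hS, hp, hn⟩ := μ.toJordanDecomposition.mutuallySingular
  have hpos : μ.toJordanDecomposition.posPart Set.univ ≤ P Set.univ := by
    rw [← measure_add_measure_compl hS, hp, zero_add]
    calc _ ≤ (μ.toJordanDecomposition.posPart + N) Sᶜ := by simp
      _ = P Sᶜ := by rw [h, Measure.add_apply, hn, add_zero]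
      _ ≤ P Set.univ := measure_mono (Set.subset_univ _)
  have hneg : μ.toJordanDecomposition.negPart Set.univ ≤ N Set.univ := by
    rw [← measure_add_measure_compl hS, hn, add_zero]
    calc _ ≤ (P + μ.toJordanDecomposition.negPart) S := by simp
      _ = N S := by rw [← h, Measure.add_apply, hp, zero_add]
      _ ≤ N Set.univ := measure_mono (Set.subset_univ _)
  rw [tv_eq_add]
  exact add_le_add (ENNReal.toReal_mono (measure_ne_top _ _) hpos)
    (ENNReal.toReal_mono (measure_ne_top _ _) hneg)

/-- The positive discrete measure with weights `c k` at the points `x k`. -/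
noncomputable def discreteMeasure {α ι : Type*} [MeasurableSpace α] [Fintype ι]
    (c : ι → NNReal) (x : ι → α) : Measure α :=
  ∑ k, c k • Measure.dirac (x k)

instance {α ι : Type*} [MeasurableSpace α] [Fintype ι] (c : ι → NNReal) (x : ι → α) :
    IsFiniteMeasure (discreteMeasure c x) := by
  unfold discreteMeasure; infer_instance

theorem discreteMeasure_real_apply {α ι : Type*} [MeasurableSpace α] [Fintype ι]
    (c : ι → NNReal) (x : ι → α) (s : Set α) :
    (discreteMeasure c x).real s = ∑ k, (c k : ℝ) * (Measure.dirac (x k)).real s := by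
  rw [discreteMeasure, measureReal_def, Measure.finsetSum_apply, ENNReal.toReal_sum]
  · simp [measureReal_def]
  · intro k _
    exact measure_ne_top _ _

theorem integral_discreteMeasure {α ι : Type*} [MeasurableSpace α] [MeasurableSingletonClass α]
    [Fintype ι] (c : ι → NNReal) (x : ι → α) (f : α → ℝ)
    (hf : ∀ (ν : Measure α) [IsFiniteMeasure ν], Integrable f ν) :
    ∫ a, f a ∂(discreteMeasure c x) = ∑ k, (c k : ℝ) * f (x k) := by
  rw [discreteMeasure, integral_finsetSum_measure fun k _ => hf _]
  simp [integral_smul_nnreal_measure, NNReal.smul_def]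

theorem sum_smul_sdirac_eq_sub {α ι : Type*} [MeasurableSpace α] [Fintype ι]
    (c : ι → ℝ) (x : ι → α) :
    ∑ k, c k • sdirac (x k) =
      (discreteMeasure (fun k => (c k).toNNReal) x).toSignedMeasure -
        (discreteMeasure (fun k => (-c k).toNNReal) x).toSignedMeasure := by
  ext s hs
  rw [sub_apply, Measure.toSignedMeasure_apply_measurable hs,
    Measure.toSignedMeasure_apply_measurable hs, discreteMeasure_real_apply,
    discreteMeasure_real_apply, ← Finset.sum_sub_distrib]
  have : (∑ k, c k • sdirac (x k)) s = ∑ k, (c k • sdirac (x k)) s := by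
    simp
  rw [this]
  refine Finset.sum_congr rfl fun k _ => ?_
  rw [← sub_mul, smul_apply, sdirac, Measure.toSignedMeasure_apply_measurable hs,
    smul_eq_mul, Real.coe_toNNReal', Real.coe_toNNReal', max_zero_sub_max_neg_zero_eq_self]

theorem sint_sum_smul_sdirac {α ι : Type*} [MeasurableSpace α] [MeasurableSingletonClass α]
    [Fintype ι] (c : ι → ℝ) (x : ι → α) (f : α → ℝ)
    (hf : ∀ (ν : Measure α) [IsFiniteMeasure ν], Integrable f ν) :
    sint (∑ k, c k • sdirac (x k)) f = ∑ k, c k * f (x k) := by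
  rw [sint_eq_of_eq_sub _ _ _ (sum_smul_sdirac_eq_sub c x) f hf, integral_discreteMeasure _ _ _ hf,
    integral_discreteMeasure _ _ _ hf, ← Finset.sum_sub_distrib]
  refine Finset.sum_congr rfl fun k _ => ?_
  rw [← sub_mul, Real.coe_toNNReal', Real.coe_toNNReal', max_zero_sub_max_neg_zero_eq_self]

theorem tv_sum_smul_sdirac_le {α ι : Type*} [MeasurableSpace α] [Fintype ι]
    (c : ι → ℝ) (x : ι → α) :
    tv (∑ k, c k • sdirac (x k)) ≤ ∑ k, |c k| := by
  refine (tv_le_of_eq_sub _ _ _ (sum_smul_sdirac_eq_sub c x)).trans_eq ?_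
  rw [discreteMeasure_real_apply, discreteMeasure_real_apply, ← Finset.sum_add_distrib]
  refine Finset.sum_congr rfl fun k _ => ?_
  rw [← add_mul, Real.coe_toNNReal', Real.coe_toNNReal', max_zero_add_max_neg_zero_eq_abs_self]
  simp

theorem integral_mem_smul_of_convex {α E : Type*} [MeasurableSpace α] [NormedAddCommGroup E]
    [NormedSpace ℝ E] [CompleteSpace E] {C : Set E} (hC : Convex ℝ C) (hCc : IsClosed C)
    (h0 : (0 : E) ∈ C) (ν : Measure α) [IsFiniteMeasure ν] {f : α → E} (hf : Integrable f ν)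
    (hfC : ∀ a, f a ∈ C) :
    ∃ z ∈ C, ∫ a, f a ∂ν = ν.real Set.univ • z := by
  rcases eq_or_ne ν 0 with rfl | hν
  · exact ⟨0, h0, by simp⟩
  · have : NeZero ν := ⟨hν⟩
    exact ⟨⨍ a, f a ∂ν, hC.average_mem hCc (Eventually.of_forall hfC) hf,
      (measure_smul_average ν f).symm⟩

/-- The least dilation factor of a compact set reaching a given point is attained. -/
theorem exists_min_dilation {E : Type*} [NormedAddCommGroup E] [NormedSpace ℝ E] {C : Set E}
    (hC : IsCompact C) {y : E} {T : ℝ} (hT : 0 ≤ T) {z : E} (hz : z ∈ C) (hy : T • z = y) :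
    ∃ t : ℝ, 0 ≤ t ∧ (∃ w ∈ C, t • w = y) ∧ ∀ s : ℝ, 0 ≤ s → (∃ w ∈ C, s • w = y) → t ≤ s := by
  have hS : IsCompact ((Set.Icc 0 T ×ˢ C) ∩ {q : ℝ × E | q.1 • q.2 = y}) :=
    (isCompact_Icc.prod hC).inter_right
      (isClosed_eq (continuous_fst.smul continuous_snd) continuous_const)
  obtain ⟨q, ⟨⟨hq, hqC⟩, hqy⟩, hmin⟩ := hS.exists_isMinOn ⟨(T, z), ⟨⟨⟨hT, le_rfl⟩, hz⟩, hy⟩⟩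
    continuous_fst.continuousOn
  refine ⟨q.1, hq.1, ⟨q.2, hqC, hqy⟩, fun s hs ⟨w, hw, hsw⟩ => ?_⟩
  rcases le_total s T with h | h
  · exact hmin (show (s, w) ∈ _ from ⟨⟨⟨hs, h⟩, hw⟩, hsw⟩)
  · exact hq.2.trans h

/-- Every point of a dilated convex hull is a combination of at most `finrank` nonzero points, of
total weight at most the dilation factor. -/
theorem exists_fin_conic_combination {E : Type*} [AddCommGroup E] [Module ℝ E]
    [FiniteDimensional ℝ E] {K : Set E} {t : ℝ} (ht : 0 ≤ t) {w : E} (hw : w ∈ convexHull ℝ K) :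
    ∃ (p : ℕ) (_ : p ≤ Module.finrank ℝ E) (c : Fin p → ℝ) (z : Fin p → E), (∀ k, 0 ≤ c k) ∧
      (∀ k, z k ∈ K ∧ z k ≠ 0) ∧ ∑ k, c k • z k = t • w ∧ ∑ k, c k ≤ t := by
  rw [convexHull_eq] at hw
  obtain ⟨ι, s, a, z, ha, ha1, hz, rfl⟩ := hw
  obtain ⟨u, c, hus, hc, hv, hsum, hli⟩ := exists_linearIndepOn_conic_combination z s
    (fun i => t * a i) (fun i hi => mul_nonneg ht (ha i hi))
  have hcard : u.card ≤ Module.finrank ℝ E := by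
    simpa using LinearIndependent.fintype_card_le_finrank hli
  refine ⟨u.card, hcard, fun k => c (u.equivFin.symm k), fun k => z (u.equivFin.symm k),
    fun k => hc _ (u.equivFin.symm k).2,
    fun k => ⟨hz _ (hus (u.equivFin.symm k).2), hli.ne_zero (u.equivFin.symm k).2⟩, ?_, ?_⟩
  · rw [u.equivFin.symm.sum_comp fun i : u => c i • z i, Finset.sum_coe_sort u fun i => c i • z i,
      hv, Finset.centerMass_eq_of_sum_1 _ _ ha1, Finset.smul_sum]
    simp [mul_smul]
  · rw [u.equivFin.symm.sum_comp fun i : u => c i, Finset.sum_coe_sort u c]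
    simpa [← Finset.mul_sum, ha1] using hsum

theorem Convex.sum_smul_mem_of_sum_le_one {ι E : Type*} [Fintype ι] [AddCommGroup E] [Module ℝ E]
    {C : Set E} (hC : Convex ℝ C) (h0 : (0 : E) ∈ C) {c : ι → ℝ} (hc : ∀ i, 0 ≤ c i)
    (hc1 : ∑ i, c i ≤ 1) {z : ι → E} (hz : ∀ i, z i ∈ C) : ∑ i, c i • z i ∈ C := by
  rcases (Finset.sum_nonneg fun i _ => hc i : 0 ≤ ∑ i, c i).eq_or_lt with h | h
  · have hc0 := (Finset.sum_eq_zero_iff_of_nonneg fun i _ => hc i).mp h.symm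
    rwa [Finset.sum_eq_zero fun i hi => by rw [hc0 i hi, zero_smul]]
  · have hmem := hC.centerMass_mem (t := Finset.univ) (fun i _ => hc i) h fun i _ => hz i
    have := hC.smul_mem_of_zero_mem h0 hmem ⟨h.le, hc1⟩
    rwa [Finset.centerMass, smul_inv_smul₀ h.ne'] at this

/-- In finite dimension, the convex hull of a compact set containing the origin is compact. -/
theorem IsCompact.convexHull_of_zero_mem {E : Type*} [NormedAddCommGroup E] [NormedSpace ℝ E]
    [FiniteDimensional ℝ E] {K : Set E} (hK : IsCompact K) (h0 : (0 : E) ∈ K) :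
    IsCompact (convexHull ℝ K) := by
  have hEq : convexHull ℝ K = ⋃ p ∈ Set.Iic (Module.finrank ℝ E),
      (fun q : (Fin p → ℝ) × (Fin p → E) => ∑ k, q.1 k • q.2 k) ''
        ((Set.Icc 0 1 ∩ {c | ∑ k, c k ≤ 1}) ×ˢ Set.univ.pi fun _ => K) := by
    ext w
    simp only [Set.mem_iUnion, Set.mem_image]
    constructor
    · intro hw
      obtain ⟨p, hp, c, z, hc, hz, hcz, hc1⟩ := exists_fin_conic_combination zero_le_one hw
      refine ⟨p, hp, (c, z), ⟨⟨⟨hc, fun k => ?_⟩, hc1⟩, fun k _ => (hz k).1⟩, by simpa using hcz⟩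
      exact (Finset.single_le_sum (fun i _ => hc i) (Finset.mem_univ k)).trans hc1
    · rintro ⟨p, -, q, ⟨⟨⟨hc, -⟩, hc1⟩, hz⟩, rfl⟩
      exact (convex_convexHull ℝ K).sum_smul_mem_of_sum_le_one (subset_convexHull ℝ K h0) hc hc1
        fun i => subset_convexHull ℝ K (hz i trivial)
  rw [hEq]
  refine (Set.finite_Iic _).isCompact_biUnion fun p _ => IsCompact.image ?_ (by fun_prop)
  exact (isCompact_Icc.inter_right (isClosed_le (by fun_prop) continuous_const)).prod
    (isCompact_univ_pi fun _ => hK)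

open scoped Pointwise in
/-- For every `y` in the range of the measurement operator `H` (integration against
`ρ_1, …, ρ_m ∈ C₀(Ω)`), the problem `min ‖μ‖_TV subject to Hμ = y` attains its minimum at a
measure of the form `Σ_{k=1}^p d_k δ_{x_k}` with `p ≤ m`. -/
theorem stmt3 {d m : ℕ} (Ω : Set (Fin d → ℝ)) (hΩ : IsOpen Ω)
    (ρ : Fin m → ZeroAtInftyContinuousMap Ω ℝ)
    (H : SignedMeasure Ω → Fin m → ℝ)
    (hH : ∀ μ i, H μ i = sint μ (fun x => ρ i x))
    (y : Fin m → ℝ) (hy : ∃ μ : SignedMeasure Ω, H μ = y) :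
    ∃ (p : ℕ) (_ : p ≤ m) (dcoef : Fin p → ℝ) (x : Fin p → Ω),
      H (∑ k, dcoef k • sdirac (x k)) = y ∧
      ∀ μ : SignedMeasure Ω, H μ = y → tv (∑ k, dcoef k • sdirac (x k)) ≤ tv μ := by
  have hint : ∀ i (ν : Measure Ω) [IsFiniteMeasure ν], Integrable (fun x => ρ i x) ν :=
    fun i ν _ => (ρ i).toBCF.integrable ν
  set φ : Ω → Fin m → ℝ := fun x i => ρ i x with hφ
  have hφc : Continuous φ := continuous_pi fun i => (ρ i).continuous
  have hφ0 : Tendsto φ (cocompact Ω) (𝓝 0) :=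
    tendsto_pi_nhds.mpr fun i => zero_at_infty (ρ i)
  have hφint : ∀ (ν : Measure Ω) [IsFiniteMeasure ν], Integrable φ ν :=
    fun ν _ => Integrable.of_eval fun i => hint i ν
  set K : Set (Fin m → ℝ) := insert 0 (Set.range φ) ∪ -insert 0 (Set.range φ) with hK
  have hK₁ : IsCompact (insert 0 (Set.range φ)) := hφ0.isCompact_insert_range_of_cocompact hφc
  have hKc : IsCompact (convexHull ℝ K) := (hK₁.union hK₁.neg).convexHull_of_zero_mem (by simp)
  have hconv := convex_convexHull ℝ K
  have h0 : (0 : Fin m → ℝ) ∈ convexHull ℝ K := subset_convexHull ℝ K (by simp [hK])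
  have hpos : ∀ x, φ x ∈ convexHull ℝ K := fun x => subset_convexHull ℝ K (by simp [hK])
  have hneg : ∀ x, -φ x ∈ convexHull ℝ K := fun x => subset_convexHull ℝ K (by simp [hK])
  have hdil : ∀ μ : SignedMeasure Ω, H μ = y → ∃ w ∈ convexHull ℝ K, tv μ • w = y := by
    intro μ hμ
    obtain ⟨z₁, hz₁, h₁⟩ := integral_mem_smul_of_convex hconv hKc.isClosed h0
      μ.toJordanDecomposition.posPart (hφint _) hpos
    obtain ⟨z₂, hz₂, h₂⟩ := integral_mem_smul_of_convex hconv hKc.isClosed h0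
      μ.toJordanDecomposition.negPart (f := fun x => -φ x) (hφint _).neg hneg
    have hy' : y = ∫ x, φ x ∂μ.toJordanDecomposition.posPart +
        ∫ x, -φ x ∂μ.toJordanDecomposition.negPart := by
      ext i
      rw [← hμ, hH, sint, Pi.add_apply, integral_neg, Pi.neg_apply, sub_eq_add_neg,
        eval_integral fun i => hint i _, eval_integral fun i => hint i _]
    have hmem : y ∈ tv μ • convexHull ℝ K := by
      rw [tv_eq_add, hconv.add_smul measureReal_nonneg measureReal_nonneg, hy', h₁, h₂]
      exact Set.add_mem_add (Set.smul_mem_smul_set hz₁) (Set.smul_mem_smul_set hz₂)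
    exact hmem
  have htv : ∀ μ : SignedMeasure Ω, 0 ≤ tv μ := fun μ => ENNReal.toReal_nonneg
  obtain ⟨μ₀, hμ₀⟩ := hy
  obtain ⟨w₀, hw₀, hy₀⟩ := hdil μ₀ hμ₀
  obtain ⟨t, ht, ⟨w, hw, hwy⟩, hmin⟩ := exists_min_dilation hKc (htv μ₀) hw₀ hy₀
  obtain ⟨p, hp, c, z, hc, hz, hcz, hct⟩ := exists_fin_conic_combination ht hw
  have hsign : ∀ k, ∃ (ε : ℝ) (x : Ω), |ε| = 1 ∧ z k = ε • φ x := by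
    intro k
    obtain ⟨hzK, hz0⟩ := hz k
    rcases hzK with (h | ⟨x, hx⟩) | (h | ⟨x, hx⟩)
    · exact absurd h hz0
    · exact ⟨1, x, by simp, by simp [hx]⟩
    · exact absurd (neg_eq_zero.mp h) hz0
    · exact ⟨-1, x, by simp, by simp [hx]⟩
  choose ε x hε hzx using hsign
  refine ⟨p, by simpa using hp, fun k => c k * ε k, x, ?_, fun μ hμ => ?_⟩
  · ext i
    rw [hH, sint_sum_smul_sdirac _ _ _ (hint i), ← hwy, ← hcz]
    simp [hzx, hφ, mul_assoc]
  · calc _ ≤ ∑ k, |c k * ε k| := tv_sum_smul_sdirac_le _ _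
      _ = ∑ k, c k := by simp [abs_mul, hε, abs_of_nonneg (hc _)]
      _ ≤ t := hct
      _ ≤ tv μ := hmin _ (htv μ) (hdil μ hμ)
end

section
/- Let m ≤ n be natural numbers, G ∈ ℝ^{m×n} a matrix, and b ∈ ran G. Then the problem min_{u ∈ ℝ^n} ‖u‖₁ subject to Gu = b has a solution with at most m nonzero coordinates, i.e. a solution of the form û = Σ_{k=1}^p c_k e_{i_k} with p ≤ m, scalars c_k ∈ ℝ and standard basis vectors e_{i_k}. -/
/-- The linear system `G u = b`, if solvable, has a solution of minimal `ℓ¹`-norm. -/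
theorem Matrix.exists_mulVec_eq_isMin_sum_abs {m n : ℕ} (G : Matrix (Fin m) (Fin n) ℝ)
    (b : Fin m → ℝ) (hb : ∃ u : Fin n → ℝ, G.mulVec u = b) :
    ∃ u : Fin n → ℝ, G.mulVec u = b ∧
      ∀ v : Fin n → ℝ, G.mulVec v = b → ∑ i, |u i| ≤ ∑ i, |v i| := by
  obtain ⟨u₀, hu₀⟩ := hb
  let K : Set (Fin n → ℝ) := {v | G.mulVec v = b ∧ ∑ i, |v i| ≤ ∑ i, |u₀ i|}
  have hcont : Continuous fun v : Fin n → ℝ => ∑ i, |v i| := by fun_prop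
  have hclosed : IsClosed K :=
    (isClosed_eq (Continuous.matrix_mulVec continuous_const continuous_id)
      continuous_const).inter (isClosed_le hcont continuous_const)
  have hK : IsCompact K := by
    refine (isCompact_closedBall (0 : Fin n → ℝ) (∑ i, |u₀ i|)).of_isClosed_subset hclosed ?_
    rintro v ⟨-, hv⟩
    rw [mem_closedBall_zero_iff, pi_norm_le_iff_of_nonneg (by positivity)]
    exact fun i => (Finset.single_le_sum (f := fun i => |v i|) (fun j _ => abs_nonneg _)
      (Finset.mem_univ i)).trans hv
  obtain ⟨u, hu, hmin⟩ := hK.exists_isMinOn ⟨u₀, hu₀, le_rfl⟩ hcont.continuousOn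
  refine ⟨u, hu.1, fun v hv => ?_⟩
  by_cases h : ∑ i, |v i| ≤ ∑ i, |u₀ i|
  · exact hmin ⟨hv, h⟩
  · exact hu.2.trans (not_le.mp h).le

/-- A matrix with `m` rows has a nonzero kernel vector supported in any given set of more than
`m` columns. -/
theorem Matrix.exists_ne_zero_mulVec_eq_zero_of_lt_ncard {m n : ℕ}
    (G : Matrix (Fin m) (Fin n) ℝ) (s : Set (Fin n)) (hs : m < s.ncard) :
    ∃ w : Fin n → ℝ, w ≠ 0 ∧ G.mulVec w = 0 ∧ ∀ i ∉ s, w i = 0 := by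
  classical
  let f : (Fin n → ℝ) →ₗ[ℝ] (Fin m → ℝ) × (↥sᶜ → ℝ) :=
    G.mulVecLin.prod (LinearMap.funLeft ℝ ℝ Subtype.val)
  have hf : LinearMap.ker f ≠ ⊥ := by
    apply LinearMap.ker_ne_bot_of_finrank_lt
    have h := Set.ncard_add_ncard_compl s
    rw [Nat.card_fin] at h
    rw [Module.finrank_prod, Module.finrank_fin_fun, Module.finrank_fin_fun,
      Module.finrank_fintype_fun_eq_card, ← Nat.card_eq_fintype_card, Nat.card_coe_set_eq]
    omega
  obtain ⟨w, hw, hw0⟩ := Submodule.exists_mem_ne_zero_of_ne_bot hf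
  have hfw : f w = 0 := hw
  exact ⟨w, hw0, congrArg Prod.fst hfw, fun i hi => congrFun (congrArg Prod.snd hfw) ⟨i, hi⟩⟩

theorem abs_add_add_abs_sub_of_abs_le {x y : ℝ} (h : |y| ≤ |x|) :
    |x + y| + |x - y| = 2 * |x| := by
  grind

/-- The minimum-`ℓ¹`-norm problem `min ‖u‖₁ subject to Gu = b`, with `G ∈ ℝ^{m×n}`, `m ≤ n`
and `b ∈ ran G`, has a solution with at most `m` nonzero coordinates. -/
theorem stmt4 {m n : ℕ} (hmn : m ≤ n) (G : Matrix (Fin m) (Fin n) ℝ) (b : Fin m → ℝ)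
    (hb : ∃ u : Fin n → ℝ, G.mulVec u = b) :
    ∃ u : Fin n → ℝ, G.mulVec u = b ∧
      (∀ v : Fin n → ℝ, G.mulVec v = b → ∑ i, |u i| ≤ ∑ i, |v i|) ∧
      Set.ncard {i : Fin n | u i ≠ 0} ≤ m := by
  let M : Set (Fin n → ℝ) := {u | G.mulVec u = b ∧
    ∀ v : Fin n → ℝ, G.mulVec v = b → ∑ i, |u i| ≤ ∑ i, |v i|}
  have hM : M.Nonempty := G.exists_mulVec_eq_isMin_sum_abs b hb
  let supp : (Fin n → ℝ) → ℕ := fun u => Set.ncard {i : Fin n | u i ≠ 0}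
  obtain ⟨u, ⟨hu, hmin⟩, hsupp⟩ : ∃ u ∈ M, ∀ v ∈ M, supp u ≤ supp v :=
    ⟨Function.argminOn supp M hM, Function.argminOn_mem supp M hM,
      fun v hv => Function.argminOn_le supp M hv⟩
  refine ⟨u, hu, hmin, ?_⟩
  by_contra! hcard
  obtain ⟨w, hw0, hGw, hw⟩ := G.exists_ne_zero_mulVec_eq_zero_of_lt_ncard _ hcard
  obtain ⟨k, hk⟩ := Function.ne_iff.mp hw0
  obtain ⟨i, hi, hle⟩ := Finset.exists_min_image (Finset.univ.filter fun j => w j ≠ 0)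
    (fun j => |u j| / |w j|) ⟨k, by simpa using hk⟩
  simp only [Finset.mem_filter, Finset.mem_univ, true_and] at hi hle
  let t := u i / w i
  have ht : ∀ j, |t * w j| ≤ |u j| := by
    intro j
    by_cases hj : w j = 0
    · simp [hj]
    · rw [abs_mul, abs_div]
      exact (le_div_iff₀ (abs_pos.mpr hj)).mp (hle j hj)
  have hsum : ∑ j, |u j + t * w j| + ∑ j, |u j - t * w j| = 2 * ∑ j, |u j| := by
    rw [← Finset.sum_add_distrib, Finset.mul_sum]
    exact Finset.sum_congr rfl fun j _ => abs_add_add_abs_sub_of_abs_le (ht j)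
  have hadd : ∑ j, |u j| ≤ ∑ j, |u j + t * w j| :=
    hmin (u + t • w) (by rw [Matrix.mulVec_add, Matrix.mulVec_smul, hGw, hu]; simp)
  have hsub : u - t • w ∈ M := by
    refine ⟨by rw [Matrix.mulVec_sub, Matrix.mulVec_smul, hGw, hu]; simp, fun v hv => ?_⟩
    refine le_trans ?_ (hmin v hv)
    simp only [Pi.sub_apply, Pi.smul_apply, smul_eq_mul]
    linarith
  refine (hsupp _ hsub).not_gt (Set.ncard_lt_ncard ?_ (Set.toFinite _))
  have hsubset : {j | (u - t • w) j ≠ 0} ⊆ {j | u j ≠ 0} := by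
    intro j hj hj0
    exact hj (by simp [hj0, hw j (by simpa using hj0)])
  refine (Set.ssubset_iff_of_subset hsubset).mpr ⟨i, fun h => hi (hw i ?_), ?_⟩
  · simpa using h
  · simp [t, hi]
end

section
/- Let μ be a finite signed Borel measure on (0,1) and ξ ∈ L¹((0,1)). Define (L⁺μ)(s) = μ((0,s]) − ∫_0^1 μ((0,t]) dt for s ∈ (0,1), set ξ̄ = ∫_0^1 ξ(t) dt and ρ(s) = ∫_0^s (ξ̄ − ξ(t)) dt. Then ρ is continuous on [0,1] with ρ(0) = ρ(1) = 0 (so ρ restricted to (0,1) belongs to C₀((0,1))), and ∫_0^1 ξ(t) (L⁺μ)(t) dt = ∫_{(0,1)} ρ(s) dμ(s). -/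
open MeasureTheory Filter Topology

/-- For the distribution function `F(t) = ν((0,t])` of a finite measure on `(0,1)`, the product
`f F` is integrable whenever `f` is. -/
theorem integrableOn_mul_distribution (ν : Measure (Set.Ioo (0 : ℝ) 1)) [IsFiniteMeasure ν]
    {f : ℝ → ℝ} (hf : IntegrableOn f (Set.Ioo 0 1)) :
    IntegrableOn (fun t => f t * ν.real (Subtype.val ⁻¹' Set.Ioc 0 t)) (Set.Ioo 0 1) := by
  have hmono : Monotone fun t : ℝ => ν.real (Subtype.val ⁻¹' Set.Ioc 0 t) := fun a b hab =>
    measureReal_mono (Set.preimage_mono (Set.Ioc_subset_Ioc_right hab))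
  refine Integrable.mul_bdd (c := ν.real Set.univ) hf hmono.measurable.aestronglyMeasurable ?_
  refine ae_of_all _ fun t => ?_
  rw [Real.norm_of_nonneg measureReal_nonneg]
  exact measureReal_mono (Set.subset_univ _)

/-- Integration by parts against the distribution function of a finite measure on `(0,1)`, for a
density of zero mean. -/
theorem integral_mul_distribution (ν : Measure (Set.Ioo (0 : ℝ) 1)) [IsFiniteMeasure ν]
    {g : ℝ → ℝ} (hg : IntegrableOn g (Set.Ioo 0 1)) (hg0 : ∫ t in Set.Ioo (0 : ℝ) 1, g t = 0) :
    ∫ t in Set.Ioo (0 : ℝ) 1, g t * ν.real (Subtype.val ⁻¹' Set.Ioc 0 t)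
      = -∫ s, (∫ t in (0 : ℝ)..s, g t) ∂ν := by
  have hS : MeasurableSet {p : ℝ × Set.Ioo (0 : ℝ) 1 | (p.2 : ℝ) ≤ p.1} :=
    measurableSet_le (by fun_prop) (by fun_prop)
  have h_integrable : Integrable (Function.uncurry fun (t : ℝ) (s : Set.Ioo (0 : ℝ) 1) =>
      (Set.Ici (s : ℝ)).indicator g t) ((volume.restrict (Set.Ioo 0 1)).prod ν) :=
    (Integrable.indicator (Integrable.comp_fst hg ν) hS).congr (ae_of_all _ fun _ => rfl)
  have hswap := integral_integral_swap h_integrable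
  have hleft : ∀ t : ℝ, ∫ s : Set.Ioo (0 : ℝ) 1, (Set.Ici (s : ℝ)).indicator g t ∂ν
      = g t * ν.real (Subtype.val ⁻¹' Set.Ioc 0 t) := by
    intro t
    have hEq : (fun s : Set.Ioo (0 : ℝ) 1 => (Set.Ici (s : ℝ)).indicator g t)
        = (Subtype.val ⁻¹' Set.Ioc 0 t).indicator fun _ => g t := by
      ext s
      by_cases h : (s : ℝ) ≤ t
      · simp [Set.indicator, h, s.2.1]
      · simp [Set.indicator, h]
    rw [hEq, integral_indicator_const _ (measurable_subtype_coe measurableSet_Ioc),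
      smul_eq_mul, mul_comm]
  have hright : ∀ s : Set.Ioo (0 : ℝ) 1,
      ∫ t in Set.Ioo (0 : ℝ) 1, (Set.Ici (s : ℝ)).indicator g t = -∫ t in (0 : ℝ)..s, g t := by
    intro s
    have hdisj : Disjoint (Set.Ioo (0 : ℝ) s) (Set.Ico (s : ℝ) 1) :=
      Set.disjoint_left.2 fun x hx hy => not_lt.2 hy.1 hx.2
    have hunion := setIntegral_union hdisj measurableSet_Ico
      (hg.mono_set (Set.Ioo_subset_Ioo_right s.2.2.le))
      (hg.mono_set fun x hx => ⟨s.2.1.trans_le hx.1, hx.2⟩)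
    rw [Set.Ioo_union_Ico_eq_Ioo s.2.1 s.2.2.le, hg0] at hunion
    have hinter : Set.Ioo (0 : ℝ) 1 ∩ Set.Ici (s : ℝ) = Set.Ico (s : ℝ) 1 := by
      ext x
      exact ⟨fun hx => ⟨hx.2, hx.1.2⟩, fun hx => ⟨⟨s.2.1.trans_le hx.1, hx.2⟩, hx.1⟩⟩
    rw [setIntegral_indicator measurableSet_Ici, hinter,
      intervalIntegral.integral_of_le s.2.1.le, integral_Ioc_eq_integral_Ioo]
    linarith
  simp_rw [hleft, hright, integral_neg] at hswap
  exact hswap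

/-- A signed measure is the difference of the two parts of its Jordan decomposition. -/
theorem signedMeasure_apply_eq_sub {α : Type*} [MeasurableSpace α] (μ : SignedMeasure α)
    {A : Set α} (hA : MeasurableSet A) :
    μ A = μ.toJordanDecomposition.posPart.real A - μ.toJordanDecomposition.negPart.real A := by
  conv_lhs => rw [← μ.toSignedMeasure_toJordanDecomposition]
  exact Measure.toSignedMeasure_sub_apply hA

/-- For a finite signed Borel measure `μ` on `(0,1)` and `ξ ∈ L¹((0,1))`, set
`(L⁺μ)(s) = μ((0,s]) − ∫_0^1 μ((0,t]) dt`, `ξ̄ = ∫_0^1 ξ` and `ρ(s) = ∫_0^s (ξ̄ − ξ(t)) dt`.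
Then `ρ` is continuous on `[0,1]` with `ρ(0) = ρ(1) = 0` (so it belongs to `C₀((0,1))`),
and `∫_0^1 ξ (L⁺μ) dt = ∫ ρ dμ`. -/
theorem stmt12 (μ : SignedMeasure (Set.Ioo (0 : ℝ) 1)) (ξ : ℝ → ℝ)
    (hξ : IntegrableOn ξ (Set.Ioo 0 1))
    (Lp : ℝ → ℝ)
    (hLp : ∀ s, Lp s = μ (Subtype.val ⁻¹' Set.Ioc 0 s)
      - ∫ t in Set.Ioo (0 : ℝ) 1, μ (Subtype.val ⁻¹' Set.Ioc 0 t))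
    (ξbar : ℝ) (hξbar : ξbar = ∫ t in Set.Ioo (0 : ℝ) 1, ξ t)
    (ρ : ℝ → ℝ) (hρ : ∀ s, ρ s = ∫ t in (0 : ℝ)..s, (ξbar - ξ t)) :
    ContinuousOn ρ (Set.Icc 0 1) ∧ ρ 0 = 0 ∧ ρ 1 = 0 ∧
    ∫ t in Set.Ioo (0 : ℝ) 1, ξ t * Lp t = sint μ (fun s => ρ s) := by
  have hc : IntegrableOn (fun _ : ℝ => ξbar) (Set.Ioo 0 1) := integrableOn_const (by simp)
  have hg : IntegrableOn (fun t => ξbar - ξ t) (Set.Ioo 0 1) := hc.sub hξ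
  have hg0 : ∫ t in Set.Ioo (0 : ℝ) 1, (ξbar - ξ t) = 0 := by
    rw [integral_sub hc hξ, ← hξbar]
    simp
  obtain rfl : ρ = fun s => ∫ t in (0 : ℝ)..s, (ξbar - ξ t) := funext hρ
  refine ⟨?_, by simp, ?_, ?_⟩
  · have hg' : IntegrableOn (fun t => ξbar - ξ t) (Set.Icc 0 1) :=
      (integrableOn_Icc_iff_integrableOn_Ioo).2 hg
    rw [← Set.uIcc_of_le (zero_le_one' ℝ)] at hg' ⊢
    exact intervalIntegral.continuousOn_primitive_interval hg'
  · simpa [intervalIntegral.integral_of_le, integral_Ioc_eq_integral_Ioo] using hg0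
  · have hF : ∀ t : ℝ, μ (Subtype.val ⁻¹' Set.Ioc 0 t)
        = μ.toJordanDecomposition.posPart.real (Subtype.val ⁻¹' Set.Ioc 0 t)
          - μ.toJordanDecomposition.negPart.real (Subtype.val ⁻¹' Set.Ioc 0 t) := fun t =>
      signedMeasure_apply_eq_sub μ (measurable_subtype_coe measurableSet_Ioc)
    have hone : IntegrableOn (fun _ : ℝ => (1 : ℝ)) (Set.Ioo 0 1) := integrableOn_const (by simp)
    have parts : ∀ (ν : Measure (Set.Ioo (0 : ℝ) 1)) [IsFiniteMeasure ν],
        ∫ s, (∫ t in (0 : ℝ)..s, (ξbar - ξ t)) ∂ν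
          = (∫ t in Set.Ioo (0 : ℝ) 1, ξ t * ν.real (Subtype.val ⁻¹' Set.Ioc 0 t))
            - ξbar * ∫ t in Set.Ioo (0 : ℝ) 1, ν.real (Subtype.val ⁻¹' Set.Ioc 0 t) := by
      intro ν _
      have h := integral_mul_distribution ν hg hg0
      simp_rw [sub_mul] at h
      rw [integral_sub (integrableOn_mul_distribution ν hc) (integrableOn_mul_distribution ν hξ),
        integral_const_mul] at h
      linarith
    have h_integrable : ∀ (ν : Measure (Set.Ioo (0 : ℝ) 1)) [IsFiniteMeasure ν],
        IntegrableOn (fun t => ν.real (Subtype.val ⁻¹' Set.Ioc 0 t)) (Set.Ioo 0 1) := by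
      intro ν _
      simpa using integrableOn_mul_distribution ν hone
    simp only [sint]
    rw [parts, parts]
    simp_rw [hLp, hF, mul_sub]
    have hpos := integrableOn_mul_distribution μ.toJordanDecomposition.posPart hξ
    have hneg := integrableOn_mul_distribution μ.toJordanDecomposition.negPart hξ
    rw [integral_sub (h_integrable _) (h_integrable _), integral_sub ?_ (hξ.mul_const _),
      integral_sub hpos hneg, integral_mul_const, ← hξbar]
    · ring
    · exact hpos.sub hneg
end
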